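/- Let n ≥ 2 be an integer and let C_tr > 0, C_sec > 0. There exists a constant C > 0, depending only on n, C_tr and C_sec, with the following property. Let d, r > 0 satisfy 2d ≤ C_sec·r ≤ 1/2, let x₀ ∈ ℝⁿ, and let D ⊆ closedBall(x₀, d) be a nonempty bounded open set such that every continuously differentiable v : ℝⁿ → ℝ satisfies the trace inequality ∫_{∂D} v² dH^{n−1} ≤ C_tr²·( d⁻¹ ∫_D v² dx + d ∫_D ‖∇v‖² dx ). Then, with R := B(x₀, C_sec·r) and B := closedBall(x₀, d), every continuously differentiable u : ℝⁿ → ℝ satisfies ∫_{∂D} u² dH^{n−1} ≤ C·( d^{n−1} r^{−n} ∫_{R∖B} u² dx + d·ζ_d ∫_R ‖∇u‖² dx ). -/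

import Mathlib

open MeasureTheory Metric Set

/-- Integration in polar coordinates for nonnegative measurable functions. -/
theorem lintegral_eq_lintegral_toSphere {E : Type*} [NormedAddCommGroup E] [NormedSpace ℝ E]
    [MeasurableSpace E] [BorelSpace E] [FiniteDimensional ℝ E] [Nontrivial E]
    (μ : Measure E) [μ.IsAddHaarMeasure] {F : E → ENNReal} (hF : Measurable F) :
    ∫⁻ x, F x ∂μ = ∫⁻ θ : sphere (0 : E) 1, (∫⁻ t in Ioi (0 : ℝ),
      ENNReal.ofReal (t ^ (Module.finrank ℝ E - 1)) * F (t • (θ : E))) ∂μ.toSphere := by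
  have hmeas : Measurable fun p : sphere (0 : E) 1 × Ioi (0 : ℝ) => F ((p.2 : ℝ) • (p.1 : E)) :=
    hF.comp (Continuous.measurable (by fun_prop))
  calc ∫⁻ x, F x ∂μ = ∫⁻ x : ({0}ᶜ : Set E), F x ∂(μ.comap (↑)) := by
        rw [lintegral_subtype_comap (measurableSet_singleton _).compl, restrict_compl_singleton]
    _ = ∫⁻ p, F ((p.2 : ℝ) • (p.1 : E))
          ∂(μ.toSphere.prod (Measure.volumeIoiPow (Module.finrank ℝ E - 1))) := by
        rw [← μ.measurePreserving_homeomorphUnitSphereProd.lintegral_comp hmeas]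
        refine lintegral_congr fun x => ?_
        congr 1
        have hx : ‖(x : E)‖ ≠ 0 := norm_ne_zero_iff.2 x.2
        simp [smul_smul, hx]
    _ = _ := by
        rw [lintegral_prod _ hmeas.aemeasurable]
        refine lintegral_congr fun θ => ?_
        rw [Measure.volumeIoiPow, lintegral_withDensity_eq_lintegral_mul]
        · exact lintegral_subtype_comap measurableSet_Ioi
            fun t : ℝ => ENNReal.ofReal (t ^ (Module.finrank ℝ E - 1)) * F (t • (θ : E))
        · exact (measurable_subtype_coe.pow_const _).ennreal_ofReal
        · exact hF.comp (Continuous.measurable (by fun_prop))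

/-- Integration in polar coordinates over an open spherical shell. -/
theorem setIntegral_shell_eq_integral_toSphere {E : Type*} [NormedAddCommGroup E]
    [NormedSpace ℝ E] [MeasurableSpace E] [BorelSpace E] [FiniteDimensional ℝ E] [Nontrivial E]
    (μ : Measure E) [μ.IsAddHaarMeasure] {h : E → ℝ} (hc : Continuous h) (h0 : ∀ x, 0 ≤ h x)
    {a b : ℝ} (ha : 0 ≤ a) (hab : a ≤ b) :
    ∫ x in {x : E | ‖x‖ ∈ Ioo a b}, h x ∂μ = ∫ θ : sphere (0 : E) 1,
      (∫ t in a..b, t ^ (Module.finrank ℝ E - 1) * h (t • (θ : E))) ∂μ.toSphere := by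
  have hS : MeasurableSet {x : E | ‖x‖ ∈ Ioo a b} := measurableSet_Ioo.preimage measurable_norm
  have hcont : ∀ θ : sphere (0 : E) 1,
      Continuous fun t : ℝ => t ^ (Module.finrank ℝ E - 1) * h (t • (θ : E)) := by
    intro θ; fun_prop
  have hparam : Continuous fun θ : sphere (0 : E) 1 =>
      ∫ t in a..b, t ^ (Module.finrank ℝ E - 1) * h (t • (θ : E)) :=
    intervalIntegral.continuous_parametric_intervalIntegral_of_continuous' (by fun_prop) _ _
  rw [integral_eq_lintegral_of_nonneg_ae (.of_forall h0) hc.aestronglyMeasurable,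
    integral_eq_lintegral_of_nonneg_ae _ hparam.aestronglyMeasurable]
  · congr 1
    rw [← lintegral_indicator hS, lintegral_eq_lintegral_toSphere μ
      (F := {x : E | ‖x‖ ∈ Ioo a b}.indicator fun x => ENNReal.ofReal (h x))
      (hc.measurable.ennreal_ofReal.indicator hS)]
    refine lintegral_congr fun θ => ?_
    have hθ : ‖(θ : E)‖ = 1 := by simp
    rw [intervalIntegral.integral_of_le hab, integral_Ioc_eq_integral_Ioo,
      ofReal_integral_eq_lintegral_ofReal
        ((hcont θ).integrableOn_Icc.mono_set Ioo_subset_Icc_self),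
      ← lintegral_indicator measurableSet_Ioi, ← lintegral_indicator measurableSet_Ioo]
    · refine lintegral_congr fun t => ?_
      by_cases ht : t ∈ Ioo a b
      · have ht0 : 0 < t := ha.trans_lt ht.1
        have : t • (θ : E) ∈ {x : E | ‖x‖ ∈ Ioo a b} := by
          simpa [norm_smul, hθ, abs_of_pos ht0] using ht
        rw [indicator_of_mem ht, indicator_of_mem (mem_Ioi.2 ht0), indicator_of_mem this,
          ENNReal.ofReal_mul (by positivity)]
      · rw [indicator_of_notMem ht]
        by_cases ht0 : 0 < t
        · have : t • (θ : E) ∉ {x : E | ‖x‖ ∈ Ioo a b} := by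
            simpa [norm_smul, hθ, abs_of_pos ht0] using ht
          rw [indicator_of_mem (mem_Ioi.2 ht0), indicator_of_notMem this, mul_zero]
        · rw [indicator_of_notMem (by simpa using ht0)]
    · filter_upwards [ae_restrict_mem measurableSet_Ioo] with t ht
      have ht0 : 0 < t := ha.trans_lt ht.1
      exact mul_nonneg (by positivity) (h0 _)
  · refine .of_forall fun θ => intervalIntegral.integral_nonneg hab fun t ht => ?_
    have := ha.trans ht.1
    exact mul_nonneg (by positivity) (h0 _)

/-- Weighted Cauchy-Schwarz bound for increments, in terms of any primitive `P` of the reciprocal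
of the weight `t ^ m`. -/
theorem sq_sub_le_of_hasDerivAt_inv_pow {f f' g P : ℝ → ℝ} {m : ℕ} {s t K : ℝ}
    (hs : 0 < s) (hst : s ≤ t) (hf : ∀ x, HasDerivAt f (f' x) x) (hf' : Continuous f')
    (hg : Continuous g) (hfg : ∀ x, f' x ^ 2 ≤ g x)
    (hP : ∀ x, 0 < x → HasDerivAt P ((x ^ m)⁻¹) x) (hK : P t - P s ≤ K) (hK0 : 0 < K) :
    (f t - f s) ^ 2 ≤ K * ∫ x in s..t, x ^ m * g x := by
  have hpos : ∀ x ∈ uIcc s t, 0 < x := fun x hx => by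
    rw [uIcc_of_le hst] at hx; exact hs.trans_le hx.1
  have hinv : ContinuousOn (fun x : ℝ => (x ^ m)⁻¹) (uIcc s t) :=
    ContinuousOn.inv₀ (by fun_prop) fun x hx => (pow_pos (hpos x hx) m).ne'
  set l : ℝ := (f t - f s) / K with hl
  have hcont : ContinuousOn (fun x : ℝ => 2 * l * f' x - l ^ 2 * (x ^ m)⁻¹) (uIcc s t) :=
    (continuousOn_const.mul hf'.continuousOn).sub (continuousOn_const.mul hinv)
  have h1 : ∫ x in s..t, (2 * l * f' x - l ^ 2 * (x ^ m)⁻¹)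
      = (2 * l * f t - l ^ 2 * P t) - (2 * l * f s - l ^ 2 * P s) :=
    intervalIntegral.integral_eq_sub_of_hasDerivAt
      (f := fun x => 2 * l * f x - l ^ 2 * P x)
      (fun x hx => ((hf x).const_mul _).sub ((hP x (hpos x hx)).const_mul _))
      hcont.intervalIntegrable
  have h2 : ∫ x in s..t, (2 * l * f' x - l ^ 2 * (x ^ m)⁻¹) ≤ ∫ x in s..t, x ^ m * g x := by
    refine intervalIntegral.integral_mono_on hst hcont.intervalIntegrable
      (Continuous.intervalIntegrable (by fun_prop) _ _) fun x hx => ?_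
    have hx0 : 0 < x ^ m := pow_pos (hs.trans_le hx.1) m
    have h3 : x ^ m * f' x ^ 2 ≤ x ^ m * g x := mul_le_mul_of_nonneg_left (hfg x) hx0.le
    have h4 : 0 ≤ (x ^ m)⁻¹ * (x ^ m * f' x - l) ^ 2 := by positivity
    have h5 : (x ^ m)⁻¹ * (x ^ m * f' x - l) ^ 2
        = x ^ m * f' x ^ 2 - (2 * l * f' x - l ^ 2 * (x ^ m)⁻¹) := by
      field_simp; ring
    linarith
  have h6 : l ^ 2 * (P t - P s) ≤ l ^ 2 * K := mul_le_mul_of_nonneg_left hK (sq_nonneg l)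
  have h7 : l * K = f t - f s := by rw [hl]; field_simp
  have h8 : l * (f t - f s) ≤ ∫ x in s..t, x ^ m * g x := by
    have : l ^ 2 * K = l * (f t - f s) := by rw [← h7]; ring
    linarith
  calc (f t - f s) ^ 2 = K * (l * (f t - f s)) := by rw [← h7]; ring
    _ ≤ _ := mul_le_mul_of_nonneg_left h8 hK0.le

/-- For `0 < s ≤ d ≤ 1 / 4`, `s |log s| ≤ d |log d|`. -/
theorem mul_neg_log_le_mul_neg_log {s d : ℝ} (hs : 0 < s) (hsd : s ≤ d) (hd : d ≤ 1 / 4) :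
    s * -Real.log s ≤ d * -Real.log d := by
  have hd0 := hs.trans_le hsd
  have he := Real.exp_one_lt_three
  have h4 : (4 : ℝ) ≤ d⁻¹ := by
    rw [le_inv_comm₀ (by norm_num) hd0]; linarith
  have hds : d⁻¹ ≤ s⁻¹ := inv_anti₀ hs hsd
  have := Real.log_div_self_antitoneOn (a := d⁻¹) (b := s⁻¹)
    (mem_Ici.2 (by linarith)) (mem_Ici.2 (by linarith)) hds
  simpa [Real.log_inv, mul_comm] using this

theorem one_le_abs_log {d : ℝ} (hd0 : 0 < d) (hd : d ≤ 1 / 4) : 1 ≤ |Real.log d| := by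
  have h : Real.log d ≤ -1 := by
    rw [Real.log_le_iff_le_exp hd0, Real.exp_neg]
    refine hd.trans ?_
    rw [one_div]
    exact inv_anti₀ (Real.exp_pos 1) (by linarith [Real.exp_one_lt_three])
  rw [abs_of_nonpos (by linarith)]; linarith

/-- Increment bound along a ray with the weight `t ^ m`. -/
theorem pow_mul_sq_sub_le {f f' g : ℝ → ℝ} {m : ℕ} (hm : 1 ≤ m) {s t d : ℝ}
    (hs : 0 < s) (hsd : s ≤ d) (hdt : d ≤ t) (hd : d ≤ 1 / 4) (ht : t ≤ 1 / 2)
    (hf : ∀ x, HasDerivAt f (f' x) x) (hf' : Continuous f')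
    (hg : Continuous g) (hfg : ∀ x, f' x ^ 2 ≤ g x) :
    s ^ m * (f t - f s) ^ 2 ≤
      d * (if m = 1 then |Real.log d| else 1) * ∫ x in s..t, x ^ m * g x := by
  have hst := hsd.trans hdt
  have hd0 := hs.trans_le hsd
  have ht0 := hs.trans_le hst
  have hI : 0 ≤ ∫ x in s..t, x ^ m * g x := intervalIntegral.integral_nonneg hst fun x hx =>
    mul_nonneg (pow_nonneg (hs.le.trans hx.1) m) ((sq_nonneg _).trans (hfg x))
  rcases eq_or_lt_of_le hm with rfl | hm
  · have hls : 1 ≤ -Real.log s := by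
      have := one_le_abs_log hs (hsd.trans hd)
      rwa [abs_of_nonpos (Real.log_nonpos hs.le (by linarith))] at this
    have h := sq_sub_le_of_hasDerivAt_inv_pow (P := Real.log) (m := 1) (K := -Real.log s)
      hs hst hf hf' hg hfg (fun x hx => by simpa using Real.hasDerivAt_log hx.ne')
      (by linarith [Real.log_nonpos ht0.le (by linarith)]) (by linarith)
    have hlog := mul_neg_log_le_mul_neg_log hs hsd hd
    rw [if_pos rfl, abs_of_nonpos (Real.log_nonpos hd0.le (by linarith))]
    calc s ^ 1 * (f t - f s) ^ 2 ≤ s * (-Real.log s * ∫ x in s..t, x ^ 1 * g x) := by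
          rw [pow_one]; exact mul_le_mul_of_nonneg_left h hs.le
      _ = (s * -Real.log s) * ∫ x in s..t, x ^ 1 * g x := by ring
      _ ≤ _ := mul_le_mul_of_nonneg_right hlog hI
  · obtain ⟨k, rfl⟩ : ∃ k, m = k + 2 := ⟨m - 2, by omega⟩
    have hk : (0 : ℝ) < k + 1 := by positivity
    have h := sq_sub_le_of_hasDerivAt_inv_pow (m := k + 2) (K := (s ^ (k + 1))⁻¹)
      (P := fun x => -((k : ℝ) + 1)⁻¹ * (x ^ (k + 1))⁻¹)
      hs hst hf hf' hg hfg (fun x hx => by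
        have := ((hasDerivAt_pow (k + 1) x).inv (pow_pos hx _).ne').const_mul (-((k : ℝ) + 1)⁻¹)
        refine this.congr_deriv ?_
        push_cast
        field_simp
        ring) (by
        have h1 : 0 ≤ (t ^ (k + 1))⁻¹ := by positivity
        have h2 : 0 ≤ (s ^ (k + 1))⁻¹ := by positivity
        have h3 : ((k : ℝ) + 1)⁻¹ ≤ 1 := inv_le_one_of_one_le₀ (by linarith [k.cast_nonneg (α := ℝ)])
        have h4 : 0 ≤ ((k : ℝ) + 1)⁻¹ := by positivity
        nlinarith [mul_nonneg h4 h1, mul_le_mul_of_nonneg_right h3 h2]) (by positivity)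
    rw [if_neg (by omega), mul_one]
    calc s ^ (k + 2) * (f t - f s) ^ 2
        ≤ s ^ (k + 2) * ((s ^ (k + 1))⁻¹ * ∫ x in s..t, x ^ (k + 2) * g x) :=
          mul_le_mul_of_nonneg_left h (by positivity)
      _ = s * ∫ x in s..t, x ^ (k + 2) * g x := by
          have : s ^ (k + 1) ≠ 0 := (pow_pos hs _).ne'
          rw [← mul_assoc, pow_succ' s (k + 1), mul_assoc s, mul_inv_cancel₀ this, mul_one]
      _ ≤ _ := mul_le_mul_of_nonneg_right hsd hI

/-- Estimate along a ray: the weighted `L²` norm of `f` on `(0, d)` is controlled by that on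
`(d, ρ)` and the weighted integral of a bound `g` of the squared derivative. -/
theorem integral_pow_mul_sq_le {f f' g : ℝ → ℝ} {m : ℕ} (hm : 1 ≤ m) {d ρ : ℝ}
    (hd : 0 < d) (hdρ : 2 * d ≤ ρ) (hρ : ρ ≤ 1 / 2)
    (hf : ∀ x, HasDerivAt f (f' x) x) (hf' : Continuous f')
    (hg : Continuous g) (hfg : ∀ x, f' x ^ 2 ≤ g x) :
    ∫ s in 0..d, s ^ m * f s ^ 2 ≤
      4 * (m + 1) * d ^ (m + 1) / ρ ^ (m + 1) * (∫ t in d..ρ, t ^ m * f t ^ 2)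
        + 2 * d ^ 2 * (if m = 1 then |Real.log d| else 1) * ∫ t in 0..ρ, t ^ m * g t := by
  have hfc : Continuous f := continuous_iff_continuousAt.2 fun x => (hf x).continuousAt
  have hρ0 : 0 < ρ := by linarith
  set Z : ℝ := if m = 1 then |Real.log d| else 1 with hZ
  have hZ0 : 0 ≤ Z := by rw [hZ]; split_ifs <;> positivity
  set G := ∫ t in 0..ρ, t ^ m * g t with hG
  set F := ∫ t in d..ρ, t ^ m * f t ^ 2 with hF
  have hg0 : ∀ x, 0 ≤ g x := fun x => (sq_nonneg _).trans (hfg x)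
  have hG0 : 0 ≤ G := intervalIntegral.integral_nonneg hρ0.le fun x hx =>
    mul_nonneg (pow_nonneg hx.1 m) (hg0 x)
  have hF0 : 0 ≤ F := intervalIntegral.integral_nonneg (by linarith) fun x hx =>
    mul_nonneg (pow_nonneg (hd.le.trans hx.1) m) (sq_nonneg _)
  set W := ∫ t in d..ρ, t ^ m with hW
  have hWlow : ρ ^ (m + 1) / (2 * (m + 1)) ≤ W := by
    have h1 : d ^ (m + 1) ≤ ρ ^ (m + 1) / 2 := by
      have h2 : (2 * d) ^ (m + 1) ≤ ρ ^ (m + 1) := pow_le_pow_left₀ (by linarith) hdρ _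
      rw [mul_pow] at h2
      have h3 : (2 : ℝ) ≤ 2 ^ (m + 1) := by
        calc (2 : ℝ) = 2 ^ 1 := by norm_num
          _ ≤ _ := pow_le_pow_right₀ (by norm_num) (by omega)
      have h4 : 0 < d ^ (m + 1) := by positivity
      nlinarith
    rw [hW, integral_pow, div_le_div_iff₀ (by positivity) (by positivity)]
    have : (0 : ℝ) < m + 1 := by positivity
    nlinarith
  have hW0 : 0 < W := lt_of_lt_of_le (by positivity) hWlow
  have hpt : ∀ s, 0 < s → s ≤ d → s ^ m * f s ^ 2 ≤
      4 * (m + 1) * d ^ m / ρ ^ (m + 1) * F + 2 * (d * Z * G) := by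
    intro s hs hsd
    have h1 : ∀ t ∈ Icc d ρ, t ^ m * (s ^ m * f s ^ 2) ≤
        2 * d ^ m * (t ^ m * f t ^ 2) + 2 * (d * Z * G) * t ^ m := by
      intro t ht
      have ht0 : 0 < t := hd.trans_le ht.1
      have h2 := pow_mul_sq_sub_le hm hs hsd ht.1 (by linarith) (by linarith [ht.2]) hf hf' hg hfg
      have h3 : ∫ x in s..t, x ^ m * g x ≤ G :=
        intervalIntegral.integral_mono_interval hs.le (hsd.trans ht.1) ht.2
          ((ae_restrict_mem measurableSet_Ioc).mono fun x hx =>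
            mul_nonneg (pow_nonneg hx.1.le m) (hg0 x))
          (Continuous.intervalIntegrable (by fun_prop) _ _)
      have h4 : s ^ m * (f t - f s) ^ 2 ≤ d * Z * G :=
        h2.trans (mul_le_mul_of_nonneg_left h3 (by positivity))
      have h5 : s ^ m ≤ d ^ m := pow_le_pow_left₀ hs.le hsd m
      have h6 : f s ^ 2 ≤ 2 * f t ^ 2 + 2 * (f t - f s) ^ 2 := by
        nlinarith [sq_nonneg (2 * f t - f s)]
      have h7 : s ^ m * f s ^ 2 ≤ 2 * d ^ m * f t ^ 2 + 2 * (d * Z * G) := by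
        have h8 := mul_le_mul_of_nonneg_left h6 (pow_pos hs m).le
        have h9 := mul_le_mul_of_nonneg_right h5 (sq_nonneg (f t))
        linarith
      have h10 := mul_le_mul_of_nonneg_left h7 (pow_pos ht0 m).le
      linarith
    have h11 : W * (s ^ m * f s ^ 2) ≤ 2 * d ^ m * F + 2 * (d * Z * G) * W := by
      have := intervalIntegral.integral_mono_on (μ := volume) (by linarith : d ≤ ρ)
        (Continuous.intervalIntegrable (by fun_prop) _ _)
        (Continuous.intervalIntegrable (by fun_prop) _ _) h1
      rwa [intervalIntegral.integral_mul_const, intervalIntegral.integral_add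
        (Continuous.intervalIntegrable (by fun_prop) _ _)
        (Continuous.intervalIntegrable (by fun_prop) _ _),
        intervalIntegral.integral_const_mul, intervalIntegral.integral_const_mul] at this
    have h12 : s ^ m * f s ^ 2 ≤ 2 * d ^ m * F / W + 2 * (d * Z * G) := by
      rw [← mul_le_mul_iff_right₀ hW0]
      refine h11.trans (le_of_eq ?_)
      field_simp
    refine h12.trans ?_
    gcongr ?_ + _
    calc 2 * d ^ m * F / W ≤ 2 * d ^ m * F / (ρ ^ (m + 1) / (2 * (m + 1))) := by gcongr
      _ = _ := by field_simp; ring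
  have hconst : 0 ≤ 4 * (m + 1) * d ^ m / ρ ^ (m + 1) * F + 2 * (d * Z * G) := by positivity
  have := intervalIntegral.integral_mono_on (μ := volume) hd.le
    (Continuous.intervalIntegrable (u := fun s => s ^ m * f s ^ 2) (by fun_prop) _ _)
    (Continuous.intervalIntegrable continuous_const _ _) (fun s hs => by
      rcases eq_or_lt_of_le hs.1 with rfl | h
      · simpa [show m ≠ 0 by omega] using hconst
      · exact hpt s h hs.2)
  rw [intervalIntegral.integral_const] at this
  refine this.trans (le_of_eq ?_)
  simp only [sub_zero, smul_eq_mul]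
  field_simp
  ring

/-- On a ball of radius `d`, the `L²` norm of a `C¹`
function is controlled by that on the shell of radii `(d, ρ)` and by its Dirichlet energy. -/
theorem setIntegral_closedBall_sq_le {E : Type*} [NormedAddCommGroup E] [InnerProductSpace ℝ E]
    [MeasurableSpace E] [BorelSpace E] [FiniteDimensional ℝ E] {n : ℕ}
    (hfin : Module.finrank ℝ E = n) (hn : 2 ≤ n) {d ρ : ℝ} (hd : 0 < d)
    (hdρ : 2 * d ≤ ρ) (hρ : ρ ≤ 1 / 2) (x₀ : E) {u : E → ℝ} (hu : ContDiff ℝ 1 u) :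
    ∫ x in closedBall x₀ d, u x ^ 2 ≤
      4 * n * d ^ n / ρ ^ n * (∫ x in ball x₀ ρ \ closedBall x₀ d, u x ^ 2)
        + 2 * d ^ 2 * (if n = 2 then |Real.log d| else 1)
          * ∫ x in ball x₀ ρ, ‖gradient u x‖ ^ 2 := by
  obtain ⟨m, rfl⟩ : ∃ m, n = m + 1 := ⟨n - 1, by omega⟩
  have hm : 1 ≤ m := by omega
  have hdρ' : d ≤ ρ := by linarith
  have hρ0 : 0 ≤ ρ := by linarith
  have hdim : Module.finrank ℝ E - 1 = m := by omega
  have hnt : Nontrivial E := Module.nontrivial_of_finrank_pos (R := ℝ) (by omega)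
  have huc : Continuous u := hu.continuous
  have hgc : Continuous (gradient u) :=
    (InnerProductSpace.toDual ℝ E).symm.continuous.comp (hu.continuous_fderiv one_ne_zero)
  have htrans : ∀ (f : E → ℝ) (s : Set E),
      ∫ x in s, f x = ∫ y in (x₀ + ·) ⁻¹' s, f (x₀ + y) := fun f s =>
    ((measurePreserving_add_left volume x₀).setIntegral_preimage_emb
      (measurableEmbedding_addLeft x₀) f s).symm
  have hball : (x₀ + ·) ⁻¹' (closedBall x₀ d) = closedBall (0 : E) d := by
    ext y; simp
  have hshell : (x₀ + ·) ⁻¹' (ball x₀ ρ \ closedBall x₀ d) = {y : E | ‖y‖ ∈ Ioo d ρ} := by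
    ext y; simp [and_comm]
  have hbig : {y : E | ‖y‖ ∈ Ioo 0 ρ} ⊆ (x₀ + ·) ⁻¹' (ball x₀ ρ) := by
    intro y hy
    simpa using hy.2
  have hae : (closedBall (0 : E) d : Set E) =ᵐ[volume] {y : E | ‖y‖ ∈ Ioo 0 d} := by
    have h0 : ∀ᵐ y : E, y ≠ 0 := by
      simp [ae_iff]
    have h1 : ∀ᵐ y : E, y ∉ sphere (0 : E) d :=
      measure_eq_zero_iff_ae_notMem.1 (Measure.addHaar_sphere volume (0 : E) d)
    refine Filter.eventuallyEq_set.2 ?_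
    filter_upwards [h0, h1] with y hy0 hy1
    simp only [mem_sphere_zero_iff_norm] at hy1
    simp only [mem_closedBall_zero_iff, mem_Ioo, norm_pos_iff]
    exact ⟨fun h => ⟨hy0, lt_of_le_of_ne h hy1⟩, fun h => h.2.le⟩
  have hsq : Continuous fun y : E => u (x₀ + y) ^ 2 := by fun_prop
  have hgrad : Continuous fun y : E => ‖gradient u (x₀ + y)‖ ^ 2 := by fun_prop
  have hpolar : ∀ {f : E → ℝ} (_ : Continuous f) (_ : ∀ x, 0 ≤ f x) {a b : ℝ} (_ : 0 ≤ a)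
      (_ : a ≤ b), ∫ x in {x : E | ‖x‖ ∈ Ioo a b}, f x = ∫ θ : sphere (0 : E) 1,
        (∫ t in a..b, t ^ m * f (t • (θ : E))) ∂(volume : Measure E).toSphere := by
    intro f hf hf0 a b ha hab
    have := setIntegral_shell_eq_integral_toSphere (volume : Measure E) hf hf0 ha hab
    rwa [hdim] at this
  have hradial : ∀ {f : E → ℝ} (_ : Continuous f) (a b : ℝ), Integrable
      (fun θ : sphere (0 : E) 1 => ∫ t in a..b, t ^ m * f (t • (θ : E)))
      (volume : Measure E).toSphere := by
    intro f hf a b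
    have hc : Continuous fun θ : sphere (0 : E) 1 => ∫ t in a..b, t ^ m * f (t • (θ : E)) :=
      intervalIntegral.continuous_parametric_intervalIntegral_of_continuous' (by fun_prop) _ _
    exact hc.integrable_of_hasCompactSupport (HasCompactSupport.of_compactSpace _)
  have hmono : ∫ y in {y : E | ‖y‖ ∈ Ioo 0 ρ}, ‖gradient u (x₀ + y)‖ ^ 2 ≤
      ∫ x in ball x₀ ρ, ‖gradient u x‖ ^ 2 := by
    rw [htrans (fun x => ‖gradient u x‖ ^ 2)]
    refine setIntegral_mono_set ?_ (.of_forall fun _ => sq_nonneg _) hbig.eventuallyLE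
    have : (x₀ + ·) ⁻¹' (ball x₀ ρ) ⊆ closedBall (0 : E) ρ := by
      intro y hy
      have : ‖y‖ < ρ := by simpa using hy
      simpa using this.le
    exact (hgrad.continuousOn.integrableOn_compact (isCompact_closedBall _ _)).mono_set this
  rw [htrans (fun x => u x ^ 2), htrans (fun x => u x ^ 2), hball, hshell,
    setIntegral_congr_set hae]
  set Z : ℝ := if m + 1 = 2 then |Real.log d| else 1 with hZ
  have hZ' : (if m = 1 then |Real.log d| else 1) = Z := by
    rw [hZ]; simp
  have hZ0 : 0 ≤ Z := by rw [hZ]; split_ifs <;> positivity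
  refine le_trans ?_ (add_le_add_right (mul_le_mul_of_nonneg_left hmono (by positivity)) _)
  rw [hpolar hsq (fun _ => sq_nonneg _) le_rfl hd.le,
    hpolar hsq (fun _ => sq_nonneg _) hd.le hdρ',
    hpolar hgrad (fun _ => sq_nonneg _) le_rfl hρ0, ← integral_const_mul, ← integral_const_mul,
    ← integral_add ((hradial hsq _ _).const_mul _) ((hradial hgrad _ _).const_mul _)]
  refine integral_mono (hradial hsq _ _)
    (((hradial hsq _ _).const_mul _).add ((hradial hgrad _ _).const_mul _)) fun θ => ?_
  have hθ : ‖(θ : E)‖ = 1 := by simp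
  have hderiv : ∀ t : ℝ, HasDerivAt (fun t : ℝ => u (x₀ + t • (θ : E)))
      (inner ℝ (gradient u (x₀ + t • (θ : E))) (θ : E)) t := by
    intro t
    have h1 : HasDerivAt (fun t : ℝ => x₀ + t • (θ : E)) (θ : E) t := by
      simpa using ((hasDerivAt_id t).smul_const (θ : E)).const_add x₀
    have h2 := ((hu.differentiable one_ne_zero) (x₀ + t • (θ : E))).hasGradientAt.hasFDerivAt
    exact (h2.comp_hasDerivAt t h1).congr_deriv (by simp)
  have h := integral_pow_mul_sq_le hm hd hdρ hρ hderiv (by fun_prop)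
    (g := fun t => ‖gradient u (x₀ + t • (θ : E))‖ ^ 2) (by fun_prop) (fun t => by
      rw [sq_le_sq, abs_of_nonneg (norm_nonneg (gradient u (x₀ + t • (θ : E))))]
      simpa [hθ] using abs_real_inner_le_norm (gradient u (x₀ + t • (θ : E))) (θ : E))
  rw [hZ'] at h
  simpa using h

/-- Lemma 3.2 of the paper (trace estimate on the hole boundary): for `n ≥ 2` and
`C_tr, C_sec > 0` there is `C > 0` depending only on `n`, `C_tr`, `C_sec` such that,
whenever `0 < 2d ≤ C_sec r ≤ 1/2`, `D ⊆ closedBall(x₀,d)` is a nonempty bounded open set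
satisfying the `d`-scaled trace inequality with constant `C_tr²`, then every `C¹` function
`u` satisfies, with `R = B(x₀, C_sec r)` and `B = closedBall(x₀,d)`,
`∫_{∂D} u² dH^{n-1} ≤ C (d^{n-1} r^{-n} ∫_{R∖B} u² + d ζ_d ∫_R ‖∇u‖²)`. -/
theorem hole_boundary_trace_estimate (n : ℕ) (hn : 2 ≤ n)
    (Ctr Csec : ℝ) (hCtr : 0 < Ctr) (hCsec : 0 < Csec) :
    ∃ C > (0 : ℝ), ∀ (d r : ℝ) (x₀ : EuclideanSpace ℝ (Fin n))
      (D : Set (EuclideanSpace ℝ (Fin n))),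
      0 < d → 0 < r → 2 * d ≤ Csec * r → Csec * r ≤ 1 / 2 →
      D.Nonempty → IsOpen D → Bornology.IsBounded D → D ⊆ closedBall x₀ d →
      (∀ v : EuclideanSpace ℝ (Fin n) → ℝ, ContDiff ℝ 1 v →
        (∫ x in frontier D, (v x) ^ 2 ∂(μH[(n : ℝ) - 1])) ≤
          Ctr ^ 2 * (d⁻¹ * (∫ x in D, (v x) ^ 2) + d * (∫ x in D, ‖gradient v x‖ ^ 2))) →
      ∀ u : EuclideanSpace ℝ (Fin n) → ℝ, ContDiff ℝ 1 u →
        (∫ x in frontier D, (u x) ^ 2 ∂(μH[(n : ℝ) - 1])) ≤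
          C * (d ^ (n - 1) / r ^ n
                * (∫ x in ball x₀ (Csec * r) \ closedBall x₀ d, (u x) ^ 2)
            + d * (if n = 2 then |Real.log d| else 1)
                * (∫ x in ball x₀ (Csec * r), ‖gradient u x‖ ^ 2)) := by
  refine ⟨Ctr ^ 2 * (4 * n / Csec ^ n + 3), by positivity, ?_⟩
  intro d r x₀ D hd hr hdr hr2 _ _ _ hDB htr u hu
  have hgc : Continuous (gradient u) :=
    (InnerProductSpace.toDual ℝ (EuclideanSpace ℝ (Fin n))).symm.continuous.comp
      (hu.continuous_fderiv one_ne_zero)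
  have hmain := setIntegral_closedBall_sq_le finrank_euclideanSpace_fin hn hd hdr hr2 x₀ hu
  have hZ1 : 1 ≤ (if n = 2 then |Real.log d| else 1) := by
    split_ifs
    · exact one_le_abs_log hd (by linarith)
    · exact le_rfl
  set Z : ℝ := if n = 2 then |Real.log d| else 1
  set S := ∫ x in ball x₀ (Csec * r) \ closedBall x₀ d, u x ^ 2
  set G := ∫ x in ball x₀ (Csec * r), ‖gradient u x‖ ^ 2
  have hS0 : 0 ≤ S := integral_nonneg fun _ => sq_nonneg _
  have hG0 : 0 ≤ G := integral_nonneg fun _ => sq_nonneg _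
  have hDu : ∫ x in D, u x ^ 2 ≤ ∫ x in closedBall x₀ d, u x ^ 2 :=
    setIntegral_mono_set
      ((hu.continuous.pow 2).continuousOn.integrableOn_compact (isCompact_closedBall _ _))
      (.of_forall fun _ => sq_nonneg _) hDB.eventuallyLE
  have hDg : ∫ x in D, ‖gradient u x‖ ^ 2 ≤ G :=
    setIntegral_mono_set
      (((hgc.norm.pow 2).continuousOn.integrableOn_compact
        (isCompact_closedBall x₀ (Csec * r))).mono_set ball_subset_closedBall)
      (.of_forall fun _ => sq_nonneg _)
      (hDB.trans (closedBall_subset_ball (by linarith))).eventuallyLE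
  refine (htr u hu).trans ?_
  rw [mul_assoc]
  refine mul_le_mul_of_nonneg_left ?_ (sq_nonneg Ctr)
  have hpow : d ^ n = d * d ^ (n - 1) := by
    rw [← pow_succ', Nat.sub_add_cancel (by omega)]
  have h1 : d⁻¹ * (∫ x in D, u x ^ 2) ≤
      4 * n / Csec ^ n * (d ^ (n - 1) / r ^ n * S) + 2 * (d * Z * G) := by
    refine (mul_le_mul_of_nonneg_left (hDu.trans hmain) (inv_pos.2 hd).le).trans (le_of_eq ?_)
    rw [hpow, mul_pow]
    field_simp
  have h2 : d * (∫ x in D, ‖gradient u x‖ ^ 2) ≤ d * Z * G := by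
    rw [mul_assoc]
    refine mul_le_mul_of_nonneg_left (hDg.trans ?_) hd.le
    exact le_mul_of_one_le_left hG0 hZ1
  have h3 : 0 ≤ d ^ (n - 1) / r ^ n * S := by positivity
  have h4 : 0 ≤ 4 * n / Csec ^ n * (d * Z * G) := by positivity
  linarith
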